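/- Let n ≥ 1 and α > 0. The (unbounded) function F on S defined by F[ζ,t,a] = a^{nα+1} satisfies L_α F = 0, its boundary value f ≡ 0 satisfies (ℒ² + n² T²) f = 0, but F is not pluriharmonic. -/

import Mathlib

noncomputable section
open MeasureTheory Filter Set
open scoped Topology BigOperators

/-- The Heisenberg group `H^n = ℂ^n × ℝ` as a set. -/
abbrev Hn (n : ℕ) : Type := (Fin n → ℂ) × ℝ

/-- The extension `S = H^n × (0,∞)`; we use `H^n × ℝ` and restrict to `a > 0`. -/
abbrev Sg (n : ℕ) : Type := Hn n × ℝ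

/-- Directional derivative of a complex valued function in direction `v`. -/
def dirD {E : Type} [NormedAddCommGroup E] [NormedSpace ℝ E]
    (v : E) (f : E → ℂ) (p : E) : ℂ := fderiv ℝ f p v

def eX (n : ℕ) (j : Fin n) : Hn n := (fun i => if i = j then (1 : ℂ) else 0, 0)
def eY (n : ℕ) (j : Fin n) : Hn n := (fun i => if i = j then Complex.I else 0, 0)
def eT (n : ℕ) : Hn n := (0, 1)

/-- `X_j = ∂_{x_j} + 2 y_j ∂_t` on `H^n`. -/
def XH (n : ℕ) (j : Fin n) (f : Hn n → ℂ) (p : Hn n) : ℂ :=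
  dirD (eX n j) f p + 2 * ((p.1 j).im : ℂ) * dirD (eT n) f p

/-- `Y_j = ∂_{y_j} - 2 x_j ∂_t` on `H^n`. -/
def YH (n : ℕ) (j : Fin n) (f : Hn n → ℂ) (p : Hn n) : ℂ :=
  dirD (eY n j) f p - 2 * ((p.1 j).re : ℂ) * dirD (eT n) f p

/-- `T = ∂_t` on `H^n`. -/
def TH (n : ℕ) (f : Hn n → ℂ) (p : Hn n) : ℂ := dirD (eT n) f p

/-- `ℒ_α = -(1/4) Σ (X_j² + Y_j²) + i α T` on `H^n`. -/
def LH (n : ℕ) (α : ℝ) (f : Hn n → ℂ) (p : Hn n) : ℂ :=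
  -(1/4) * ∑ j, (XH n j (XH n j f) p + YH n j (YH n j f) p) + Complex.I * (α : ℂ) * TH n f p

/-- `Z̄_j = (1/2)(X_j + i Y_j)` on `H^n`. -/
def ZbarH (n : ℕ) (j : Fin n) (f : Hn n → ℂ) (p : Hn n) : ℂ :=
  (1/2) * (XH n j f p + Complex.I * YH n j f p)

/-- A function is bounded. -/
def BddFun {X : Type} (f : X → ℂ) : Prop := ∃ C, ∀ p, ‖f p‖ ≤ C

def eXS (n : ℕ) (j : Fin n) : Sg n := (eX n j, 0)
def eYS (n : ℕ) (j : Fin n) : Sg n := (eY n j, 0)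
def eTS (n : ℕ) : Sg n := (eT n, 0)
def eA (n : ℕ) : Sg n := (0, 1)

/-- `X_j` on `S`. -/
def XS (n : ℕ) (j : Fin n) (F : Sg n → ℂ) (p : Sg n) : ℂ :=
  dirD (eXS n j) F p + 2 * ((p.1.1 j).im : ℂ) * dirD (eTS n) F p

/-- `Y_j` on `S`. -/
def YS (n : ℕ) (j : Fin n) (F : Sg n → ℂ) (p : Sg n) : ℂ :=
  dirD (eYS n j) F p - 2 * ((p.1.1 j).re : ℂ) * dirD (eTS n) F p

/-- `T = ∂_t` on `S`. -/
def TS (n : ℕ) (F : Sg n → ℂ) (p : Sg n) : ℂ := dirD (eTS n) F p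

/-- `∂_a` on `S`. -/
def DA (n : ℕ) (F : Sg n → ℂ) : Sg n → ℂ := fun p => dirD (eA n) F p

/-- `ℒ = -(1/4) Σ (X_j² + Y_j²)` acting in the `H^n`-variables on `S`. -/
def LS0 (n : ℕ) (F : Sg n → ℂ) (p : Sg n) : ℂ :=
  -(1/4) * ∑ j, (XS n j (XS n j F) p + YS n j (YS n j F) p)

/-- `L_α = -α a (ℒ + n ∂_a) + a² (∂_a² + T²)` on `S`. -/
def Lalpha (n : ℕ) (α : ℝ) (F : Sg n → ℂ) (p : Sg n) : ℂ :=
  -(α : ℂ) * (p.2 : ℂ) * (LS0 n F p + (n : ℂ) * DA n F p)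
    + (p.2 : ℂ) ^ 2 * (DA n (DA n F) p + TS n (TS n F) p)

/-- The complex space `ℂ^{n+1}` in which the Siegel upper half-plane lives. -/
abbrev Vn (n : ℕ) : Type := (Fin n → ℂ) × ℂ

/-- The Siegel upper half-plane `U^n`. -/
def Un (n : ℕ) : Set (Vn n) := {z | ∑ j, ‖z.1 j‖ ^ 2 < z.2.im}

/-- The function `F_u` on the Siegel upper half-plane corresponding to a function `F` on `S`,
via `F[ζ,t,a] = F_u(ζ, t + i|ζ|² + ia)`, i.e.
`F_u(z', z_{n+1}) = F(z', Re z_{n+1}, Im z_{n+1} - |z'|²)`. -/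
def Fu (n : ℕ) (F : Sg n → ℂ) : Vn n → ℂ :=
  fun z => F ((z.1, z.2.re), z.2.im - ∑ j, ‖z.1 j‖ ^ 2)

/-- `F` is holomorphic if `F_u` is holomorphic on `U^n`. -/
def IsHolo (n : ℕ) (F : Sg n → ℂ) : Prop := DifferentiableOn ℂ (Fu n F) (Un n)

/-- `F` is anti-holomorphic if the conjugate of `F_u` is holomorphic on `U^n`. -/
def IsAntiHolo (n : ℕ) (F : Sg n → ℂ) : Prop :=
  DifferentiableOn ℂ (fun z => (starRingEnd ℂ) (Fu n F z)) (Un n)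

/-- Wirtinger derivative `∂_z` in complex direction `v`. -/
def dzV (n : ℕ) (v : Vn n) (f : Vn n → ℂ) (p : Vn n) : ℂ :=
  (1/2) * (fderiv ℝ f p v - Complex.I * fderiv ℝ f p (Complex.I • v))

/-- Wirtinger derivative `∂_{z̄}` in complex direction `v`. -/
def dzbarV (n : ℕ) (v : Vn n) (f : Vn n → ℂ) (p : Vn n) : ℂ :=
  (1/2) * (fderiv ℝ f p v + Complex.I * fderiv ℝ f p (Complex.I • v))

/-- The standard complex basis vectors of `ℂ^{n+1} = ℂ^n × ℂ`. -/
def basisV (n : ℕ) (k : Fin (n + 1)) : Vn n :=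
  if _h : (k : ℕ) < n then (fun i => if (i : ℕ) = (k : ℕ) then (1 : ℂ) else 0, 0) else (0, 1)

/-- `F` is pluriharmonic if `∂_{z_k} ∂_{z̄_j} F_u = 0` on `U^n` for all `1 ≤ j,k ≤ n+1`. -/
def IsPluriharmonic (n : ℕ) (F : Sg n → ℂ) : Prop :=
  ∀ p ∈ Un n, ∀ j k : Fin (n + 1),
    dzV n (basisV n k) (dzbarV n (basisV n j) (Fu n F)) p = 0

/-- `f` is the boundary value of `F` : for every `φ ∈ L¹(H^n)`,
`∫ F(w,a) φ(w) dw → ∫ f(w) φ(w) dw` as `a → 0⁺`. -/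
def IsBoundaryValue (n : ℕ) (F : Sg n → ℂ) (f : Hn n → ℂ) : Prop :=
  ∀ φ : Hn n → ℂ, Integrable φ →
    Tendsto (fun a : ℝ => ∫ w : Hn n, F (w, a) * φ w) (𝓝[>] (0 : ℝ))
      (𝓝 (∫ w : Hn n, f w * φ w))

theorem aux_fderiv {E : Type} [NormedAddCommGroup E] [NormedSpace ℝ E] (g : ℝ → ℝ) (g' : ℝ)
    (R : E → ℝ) (p v : E) (hR : DifferentiableAt ℝ R p) (hg : HasDerivAt g g' (R p)) :
    fderiv ℝ (fun q => ((g (R q) : ℝ) : ℂ)) p v = ((g' * fderiv ℝ R p v : ℝ) : ℂ) := by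
  have h1 : HasFDerivAt (fun q => g (R q)) (g' • fderiv ℝ R p) p :=
    hg.comp_hasFDerivAt p hR.hasFDerivAt
  have h2 : HasFDerivAt (fun q => ((g (R q) : ℝ) : ℂ))
      (Complex.ofRealCLM.comp (g' • fderiv ℝ R p)) p :=
    Complex.ofRealCLM.hasFDerivAt.comp p h1
  rw [h2.fderiv]
  simp

theorem aux_fderiv_const {E : Type} [NormedAddCommGroup E] [NormedSpace ℝ E] (p v : E) :
    fderiv ℝ (fun _ : E => (0 : ℂ)) p v = 0 := by
  simp

def auxR (n : ℕ) (z : Vn n) : ℝ := z.2.im - ∑ j, ‖z.1 j‖ ^ 2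

theorem auxR_diff (n : ℕ) (z : Vn n) : DifferentiableAt ℝ (auxR n) z := by
  unfold auxR
  refine DifferentiableAt.sub ?_ ?_
  · exact (Complex.imCLM.differentiableAt).comp z differentiableAt_snd
  · refine DifferentiableAt.fun_sum fun j _ => ?_
    refine DifferentiableAt.norm_sq ℝ ?_
    fun_prop

theorem auxR_fderiv (n : ℕ) (z : Vn n) (c : ℂ) : fderiv ℝ (auxR n) z (0, c) = c.im := by
  rw [← (auxR_diff n z).lineDeriv_eq_fderiv]
  have : HasDerivAt (fun t : ℝ => auxR n (z + t • ((0, c) : Vn n))) c.im 0 := by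
    have h : (fun t : ℝ => auxR n (z + t • ((0, c) : Vn n))) =
        fun t : ℝ => t * c.im + auxR n z := by
      funext t
      simp [auxR]
      ring
    rw [h]
    simpa using ((hasDerivAt_id (0 : ℝ)).mul_const c.im).add_const (auxR n z)
  exact this.deriv

/-- The unbounded function `F[ζ,t,a] = a^{nα+1}` on `S` is `L_α`-harmonic,
its boundary value `f ≡ 0` satisfies `(ℒ² + n² T²) f = 0`, but `F` is not pluriharmonic. -/
theorem stmt4 (n : ℕ) (hn : 1 ≤ n) (α : ℝ) (hα : 0 < α) :
    let F : Sg n → ℂ := fun p => ((p.2 ^ ((n : ℝ) * α + 1) : ℝ) : ℂ)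
    (∀ p : Sg n, 0 < p.2 → Lalpha n α F p = 0) ∧
    IsBoundaryValue n F (0 : Hn n → ℂ) ∧
    (∀ w : Hn n, LH n 0 (LH n 0 (0 : Hn n → ℂ)) w
        + (n : ℂ) ^ 2 * TH n (TH n (0 : Hn n → ℂ)) w = 0) ∧
    ¬ IsPluriharmonic n F := by
  intro F
  set s : ℝ := (n : ℝ) * α + 1 with hs
  have hn' : (0 : ℝ) < n := by exact_mod_cast hn
  have hs1 : 1 < s := by
    have := mul_pos hn' hα
    linarith
  have hF : ∀ p v : Sg n, fderiv ℝ F p v = ((s * p.2 ^ (s - 1) * v.2 : ℝ) : ℂ) := by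
    intro p v
    have h := aux_fderiv (fun x : ℝ => x ^ s) (s * p.2 ^ (s - 1)) (fun q : Sg n => q.2) p v
      differentiableAt_snd (Real.hasDerivAt_rpow_const (Or.inr hs1.le))
    have h2 : fderiv ℝ (fun q : Sg n => q.2) p v = v.2 := by
      have e : HasFDerivAt (fun q : Sg n => q.2) (ContinuousLinearMap.snd ℝ (Hn n) ℝ) p :=
        hasFDerivAt_snd
      rw [e.fderiv]
      simp
    rw [h2] at h
    exact h
  refine ⟨?_, ?_, ?_, ?_⟩
  · intro p hp
    have hT : TS n F = fun _ => 0 := by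
      funext q
      simp [TS, dirD, hF, eTS]
    have hX : ∀ j, XS n j F = fun _ => 0 := by
      intro j
      funext q
      simp [XS, dirD, hF, eTS, eXS]
    have hY : ∀ j, YS n j F = fun _ => 0 := by
      intro j
      funext q
      simp [YS, dirD, hF, eTS, eYS]
    have hA : DA n F = fun q : Sg n => ((s * q.2 ^ (s - 1) : ℝ) : ℂ) := by
      funext q
      simp [DA, dirD, hF, eA]
    have hAA : DA n (DA n F) p = ((s * ((s - 1) * p.2 ^ (s - 1 - 1)) : ℝ) : ℂ) := by
      rw [hA]
      have h := aux_fderiv (fun x : ℝ => s * x ^ (s - 1)) (s * ((s - 1) * p.2 ^ (s - 1 - 1)))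
        (fun q : Sg n => q.2) p (eA n)
        differentiableAt_snd ((Real.hasDerivAt_rpow_const (Or.inl hp.ne')).const_mul s)
      have h2 : fderiv ℝ (fun q : Sg n => q.2) p (eA n) = 1 := by
        have e : HasFDerivAt (fun q : Sg n => q.2) (ContinuousLinearMap.snd ℝ (Hn n) ℝ) p :=
          hasFDerivAt_snd
        rw [e.fderiv]
        simp [eA]
      rw [h2, mul_one] at h
      exact h
    have hL : LS0 n F p = 0 := by
      simp [LS0, hX, hY, XS, YS, dirD]
    have hTT : TS n (TS n F) p = 0 := by
      rw [hT]
      simp [TS, dirD]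
    unfold Lalpha
    rw [hAA, hL, hTT, hA]
    have e1 : p.2 ^ (s - 1) = p.2 ^ (s - 1 - 1) * p.2 := by
      rw [← Real.rpow_add_one hp.ne']
      congr 1
      ring
    have e2 : s - 1 = n * α := by rw [hs]; ring
    have key : -α * p.2 * (n * (s * p.2 ^ (s - 1)))
        + p.2 ^ 2 * (s * ((s - 1) * p.2 ^ (s - 1 - 1))) = 0 := by
      rw [e1]
      generalize p.2 ^ (s - 1 - 1) = y
      rw [e2]
      ring
    have := congrArg (fun x : ℝ => (x : ℂ)) key
    simp only [Complex.ofReal_zero] at this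
    refine Eq.trans ?_ this
    push_cast
    ring
  · intro φ hφ
    have h0 : (∫ w : Hn n, (0 : Hn n → ℂ) w * φ w) = 0 := by simp
    rw [h0]
    have h1 : (fun a : ℝ => ∫ w : Hn n, F (w, a) * φ w) =
        fun a : ℝ => ((a ^ s : ℝ) : ℂ) * ∫ w : Hn n, φ w := by
      funext a
      exact integral_const_mul (((a ^ s : ℝ) : ℂ)) φ
    rw [h1]
    have hc : Continuous fun a : ℝ => ((a ^ s : ℝ) : ℂ) * ∫ w : Hn n, φ w :=
      (Complex.continuous_ofReal.comp
        (Real.continuous_rpow_const (by linarith))).mul continuous_const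
    have h2 := hc.tendsto 0
    rw [Real.zero_rpow (by linarith)] at h2
    simp only [Complex.ofReal_zero, zero_mul] at h2
    exact h2.mono_left nhdsWithin_le_nhds
  · intro w
    have hT : TH n (0 : Hn n → ℂ) = 0 := by
      funext q
      simp [TH, dirD]
    have hX : ∀ j, XH n j (0 : Hn n → ℂ) = 0 := by
      intro j
      funext q
      simp [XH, dirD]
    have hY : ∀ j, YH n j (0 : Hn n → ℂ) = 0 := by
      intro j
      funext q
      simp [YH, dirD]
    have hL : LH n 0 (0 : Hn n → ℂ) = 0 := by
      funext q
      simp [LH, hX, hY]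
    simp [hL, hT]
  · intro hP
    have hmem : ((0, Complex.I) : Vn n) ∈ Un n := by
      simp [Un]
    have h := hP (0, Complex.I) hmem (Fin.last n) (Fin.last n)
    have hb : basisV n (Fin.last n) = (0, 1) := by simp [basisV]
    have hI : (Complex.I • ((0, 1) : Vn n)) = (0, Complex.I) := by simp
    rw [hb] at h
    have hd : dzbarV n (0, 1) (Fu n F) =
        fun z => (Complex.I / 2) * (((s * auxR n z ^ (s - 1) : ℝ)) : ℂ) := by
      funext z
      have h1 : ∀ c : ℂ, fderiv ℝ (Fu n F) z (0, c)
          = ((s * auxR n z ^ (s - 1) * c.im : ℝ) : ℂ) := by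
        intro c
        have h := aux_fderiv (fun x : ℝ => x ^ s) (s * auxR n z ^ (s - 1)) (auxR n) z (0, c)
          (auxR_diff n z) (Real.hasDerivAt_rpow_const (Or.inr hs1.le))
        rw [auxR_fderiv] at h
        exact h
      unfold dzbarV
      rw [hI, h1, h1]
      simp
      ring
    have hR1 : auxR n (0, Complex.I) = 1 := by simp [auxR]
    have h2 : ∀ c : ℂ, fderiv ℝ (dzbarV n (0, 1) (Fu n F)) (0, Complex.I) (0, c)
        = (Complex.I / 2) * ((s * (s - 1) * c.im : ℝ) : ℂ) := by
      intro c
      have hder : HasDerivAt (fun x : ℝ => s * x ^ (s - 1)) (s * (s - 1))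
          (auxR n (0, Complex.I)) := by
        rw [hR1]
        have := (Real.hasDerivAt_rpow_const (x := 1) (p := s - 1)
          (Or.inl one_ne_zero)).const_mul s
        simpa using this
      have h := aux_fderiv (fun x : ℝ => s * x ^ (s - 1)) (s * (s - 1)) (auxR n)
        (0, Complex.I) (0, c) (auxR_diff n _) hder
      rw [auxR_fderiv] at h
      rw [hd, fderiv_const_mul]
      · rw [← h]
        simp
      · exact Complex.ofRealCLM.differentiableAt.comp _
          (hder.differentiableAt.comp _ (auxR_diff n _))
    unfold dzV at h
    rw [hI, h2, h2] at h
    have h3 : ((s * (s - 1) : ℝ) : ℂ) = 0 := by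
      have e : (1 / 2 : ℂ) * (Complex.I / 2 * ((s * (s - 1) * (1 : ℂ).im : ℝ) : ℂ)
          - Complex.I * (Complex.I / 2 * ((s * (s - 1) * Complex.I.im : ℝ) : ℂ)))
          = (1 / 4) * ((s * (s - 1) : ℝ) : ℂ) := by
        simp only [Complex.one_im, Complex.I_im, mul_zero, mul_one, Complex.ofReal_zero]
        linear_combination (-(1 / 4) * ((s * (s - 1) : ℝ) : ℂ)) * Complex.I_mul_I
      rw [e] at h
      simpa using h
    have h4 : s * (s - 1) = 0 := by exact_mod_cast h3
    have : 0 < s * (s - 1) := mul_pos (by linarith) (by linarith)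
    linarith
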